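/- Let n ≥ 3 and let Ω ⊂ ℝⁿ be a bounded open set whose boundary ∂Ω is Ahlfors regular with constants C₁, C₂, and let α > 1. Then there exists C > 0, depending only on n, α, C₁, C₂, such that for every u : ℝⁿ → ℝ differentiable on Ω with ∫_Ω |∇u|² dX < ∞ and every surface ball Δ = Δ(Q₀, r) with 0 < r ≤ diam Ω: ∫_{T(Δ)} |∇u(X)|² δ(X) dX ≤ C ∫_{Δ(Q₀, (α+1)r)} (S^α_{αr} u(Q))² dσ(Q). -/

import Mathlib

open MeasureTheory Metric Set Filter Bornology
open scoped ENNReal NNReal Topology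

noncomputable section

abbrev En (n : ℕ) : Type := EuclideanSpace ℝ (Fin n)

def AhlforsRegular (n : ℕ) (Ω : Set (En n)) (C₁ C₂ : ℝ) : Prop :=
  ∀ Q ∈ frontier Ω, ∀ r : ℝ, 0 < r → r ≤ diam Ω →
    ENNReal.ofReal (C₁ * r ^ (n - 1)) ≤ μH[(n : ℝ) - 1] (ball Q r ∩ frontier Ω) ∧
      μH[(n : ℝ) - 1] (ball Q r ∩ frontier Ω) ≤ ENNReal.ofReal (C₂ * r ^ (n - 1))

/-- Truncated square function `S^α_r u(Q)`. -/
def trSq (n : ℕ) (Ω : Set (En n)) (α r : ℝ) (u : En n → ℝ) (Q : En n) : ℝ :=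
  Real.sqrt (∫ X in {X ∈ Ω | dist X Q ≤ α * infDist X (frontier Ω)} ∩ ball Q r,
    ‖fderiv ℝ u X‖ ^ 2 * infDist X (frontier Ω) ^ ((2 : ℝ) - n))


/-- The pairs `(Q, X)` with `X` in the truncated cone at `Q`. -/
def coneSet (n : ℕ) (Ω : Set (En n)) (α r : ℝ) : Set (En n × En n) :=
  {p | (p.2 ∈ Ω ∧ dist p.2 p.1 ≤ α * infDist p.2 (frontier Ω)) ∧ dist p.2 p.1 < r}

lemma coneSet_meas (n : ℕ) (Ω : Set (En n)) (hΩ : IsOpen Ω) (α r : ℝ) :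
    MeasurableSet (coneSet n Ω α r) := by
  unfold coneSet
  refine MeasurableSet.inter (MeasurableSet.inter ?_ ?_) ?_
  · exact measurable_snd hΩ.measurableSet
  · exact measurableSet_le (measurable_snd.dist measurable_fst)
      (((continuous_infDist_pt _).measurable.comp measurable_snd).const_mul _)
  · exact measurableSet_lt (measurable_snd.dist measurable_fst) measurable_const

lemma infDist_pos_of {n : ℕ} {Ω : Set (En n)} (hΩ : IsOpen Ω) (hne : (frontier Ω).Nonempty)
    {X : En n} (hX : X ∈ Ω) : 0 < infDist X (frontier Ω) := by
  rw [← isClosed_frontier.notMem_iff_infDist_pos hne]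
  intro h
  rw [hΩ.frontier_eq] at h
  exact h.2 hX

lemma exists_near {n : ℕ} {Ω : Set (En n)} (hb : IsBounded Ω) (hne : (frontier Ω).Nonempty)
    (X : En n) : ∃ P ∈ frontier Ω, infDist X (frontier Ω) = dist X P :=
  isClosed_frontier.exists_infDist_eq_dist hne X

lemma sigma_finite' {n : ℕ} {Ω : Set (En n)} {C₁ C₂ : ℝ} (hb : IsBounded Ω)
    (hA : AhlforsRegular n Ω C₁ C₂) (hd : 0 < diam Ω) :
    μH[(n : ℝ) - 1] (frontier Ω) < ∞ := by
  have hc : IsCompact (frontier Ω) :=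
    hb.isCompact_closure.of_isClosed_subset isClosed_frontier frontier_subset_closure
  obtain ⟨t, ht, htf, hcov⟩ := hc.finite_cover_balls hd
  have : frontier Ω ⊆ ⋃ x ∈ t, (ball x (diam Ω) ∩ frontier Ω) := by
    intro y hy
    have := hcov hy
    simp only [mem_iUnion] at this ⊢
    obtain ⟨x, hx, hyx⟩ := this
    exact ⟨x, hx, hyx, hy⟩
  refine (measure_mono this).trans_lt ?_
  refine measure_biUnion_lt_top htf fun x hx => ?_
  exact ((hA x (ht hx) _ hd le_rfl).2).trans_lt ENNReal.ofReal_lt_top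

lemma lower_bd {n : ℕ} {Ω : Set (En n)} {C₁ C₂ α : ℝ} (hΩ : IsOpen Ω) (hb : IsBounded Ω)
    (hC₁ : 0 < C₁) (hα : 1 < α)
    (hA : AhlforsRegular n Ω C₁ C₂) {Q₀ : En n} (hQ : Q₀ ∈ frontier Ω) {r : ℝ}
    (hrd : r ≤ diam Ω) {X : En n} (hX : X ∈ ball Q₀ r ∩ Ω) :
    ENNReal.ofReal (C₁ * (min (α - 1) 1) ^ (n - 1) * infDist X (frontier Ω) ^ (n - 1)) ≤
      (μH[(n : ℝ) - 1].restrict (ball Q₀ ((α + 1) * r) ∩ frontier Ω))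
        ((fun Q => (Q, X)) ⁻¹' coneSet n Ω α (α * r)) := by
  obtain ⟨P, hP, hPX⟩ := exists_near hb ⟨_, hQ⟩ X
  have hpos := infDist_pos_of hΩ ⟨_, hQ⟩ hX.2
  have hlt : infDist X (frontier Ω) < r := (infDist_le_dist_of_mem hQ).trans_lt hX.1
  set d := infDist X (frontier Ω) with hd
  set m := min (α - 1) 1 with hm
  have hm0 : 0 < m := lt_min (by linarith) one_pos
  have hm1 : m ≤ 1 := min_le_right _ _
  have hm2 : m ≤ α - 1 := min_le_left _ _
  have hmd : m * d ≤ d := by nlinarith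
  have h1 := (hA P hP (m * d) (by positivity) (by linarith)).1
  have hmeas : MeasurableSet ((fun Q => (Q, X)) ⁻¹' coneSet n Ω α (α * r)) :=
    measurable_prodMk_right (coneSet_meas n Ω hΩ α (α * r))
  rw [Measure.restrict_apply hmeas]
  rw [mul_pow, ← mul_assoc] at h1
  refine h1.trans (measure_mono ?_)
  rintro Q ⟨hQ1, hQ2⟩
  have hQP : dist P Q < m * d := by rw [dist_comm]; exact hQ1
  have hXQ : dist X Q < α * d := by
    have := dist_triangle X P Q
    nlinarith
  have hX0 : dist X Q₀ < r := hX.1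
  refine ⟨⟨⟨hX.2, hXQ.le⟩, ?_⟩, ?_, hQ2⟩
  · show dist X Q < α * r
    nlinarith
  · show dist Q Q₀ < (α + 1) * r
    have := dist_triangle Q X Q₀
    rw [dist_comm Q X] at this
    nlinarith

lemma upper_bd {n : ℕ} {Ω : Set (En n)} {C₁ C₂ α : ℝ} (hΩ : IsOpen Ω) (hb : IsBounded Ω)
    (hα : 1 < α) (hC₂ : 0 < C₂)
    (hA : AhlforsRegular n Ω C₁ C₂) (hne : (frontier Ω).Nonempty) (hd : 0 < diam Ω) (ρ R : ℝ)
    (Q₀ : En n) :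
    ∃ K : ℝ, 0 ≤ K ∧ ∀ X ∈ Ω,
      (μH[(n : ℝ) - 1].restrict (ball Q₀ R ∩ frontier Ω))
        ((fun Q => (Q, X)) ⁻¹' coneSet n Ω α ρ) ≤
      ENNReal.ofReal (K * infDist X (frontier Ω) ^ (n - 1)) := by
  have hfin := sigma_finite' hb hA hd
  set M := (μH[(n : ℝ) - 1] (frontier Ω)).toReal with hM
  have hM0 : 0 ≤ M := ENNReal.toReal_nonneg
  set c := diam Ω / (α + 2) with hc
  have hc0 : 0 < c := by positivity
  refine ⟨C₂ * (α + 2) ^ (n - 1) + M / c ^ (n - 1), by positivity, fun X hX => ?_⟩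
  obtain ⟨P, hP, hPX⟩ := exists_near hb hne X
  have hpos := infDist_pos_of hΩ hne hX
  set d := infDist X (frontier Ω) with hdd
  have hmeas : MeasurableSet ((fun Q => (Q, X)) ⁻¹' coneSet n Ω α ρ) :=
    measurable_prodMk_right (coneSet_meas n Ω hΩ α ρ)
  rw [Measure.restrict_apply hmeas, add_mul]
  by_cases h : (α + 2) * d ≤ diam Ω
  · have h1 := (hA P hP ((α + 2) * d) (by positivity) h).2
    refine le_trans (measure_mono ?_) (h1.trans (ENNReal.ofReal_le_ofReal ?_))
    · rintro Q ⟨⟨⟨_, hQ1⟩, _⟩, _, hQ2⟩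
      refine ⟨?_, hQ2⟩
      have hQ1' : dist X Q ≤ α * d := hQ1
      show dist Q P < (α + 2) * d
      have := dist_triangle Q X P
      rw [dist_comm Q X] at this
      nlinarith
    · rw [mul_pow, ← mul_assoc]
      have : 0 ≤ M / c ^ (n - 1) * d ^ (n - 1) := by positivity
      linarith
  · have hcd : c ≤ d := by
      rw [hc, div_le_iff₀ (by linarith)]
      linarith
    have h2 : M ≤ M / c ^ (n - 1) * d ^ (n - 1) := by
      rw [div_mul_eq_mul_div, le_div_iff₀ (by positivity)]
      gcongr
    refine le_trans (measure_mono (t := frontier Ω) fun Q hQ => hQ.2.2) ?_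
    rw [← ENNReal.ofReal_toReal hfin.ne]
    refine ENNReal.ofReal_le_ofReal ?_
    have : 0 ≤ C₂ * (α + 2) ^ (n - 1) * d ^ (n - 1) := by positivity
    linarith

lemma rpow_mul_pow' {n : ℕ} (hn : 3 ≤ n) {d : ℝ} (hd : 0 < d) :
    d ^ ((2 : ℝ) - n) * d ^ (n - 1) = d := by
  rw [← Real.rpow_natCast d (n - 1), ← Real.rpow_add hd]
  have : ((n - 1 : ℕ) : ℝ) = n - 1 := by
    rw [Nat.cast_sub (by omega)]; simp
  rw [this]
  ring_nf
  simp

/-- the Carleson integral over `T(Δ) = B(Q₀,r) ∩ Ω` is controlled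
by the truncated square function:
`∫_{T(Δ)} |∇u|² δ(X) dX ≤ C ∫_{Δ(Q₀,(α+1)r)} (S^α_{αr} u)² dσ`, with
`C = C(n, α, C₁, C₂) > 0`. -/
theorem stmt12 (n : ℕ) (hn : 3 ≤ n) (C₁ C₂ α : ℝ) (hC₁ : 0 < C₁) (hC₁₂ : C₁ ≤ C₂)
    (hα : 1 < α) :
    ∃ C : ℝ, 0 < C ∧
      ∀ Ω : Set (En n), IsOpen Ω → IsBounded Ω → AhlforsRegular n Ω C₁ C₂ →
        ∀ u : En n → ℝ, DifferentiableOn ℝ u Ω →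
          IntegrableOn (fun X => ‖fderiv ℝ u X‖ ^ 2) Ω →
          ∀ Q₀ ∈ frontier Ω, ∀ r : ℝ, 0 < r → r ≤ diam Ω →
            ∫ X in ball Q₀ r ∩ Ω, ‖fderiv ℝ u X‖ ^ 2 * infDist X (frontier Ω) ≤
              C * ∫ Q in ball Q₀ ((α + 1) * r) ∩ frontier Ω,
                trSq n Ω α (α * r) u Q ^ 2 ∂μH[(n : ℝ) - 1] := by
  set m := min (α - 1) 1 with hm
  have hm0 : 0 < m := lt_min (by linarith) one_pos
  have hc0 : 0 < C₁ * m ^ (n - 1) := by positivity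
  refine ⟨(C₁ * m ^ (n - 1))⁻¹, by positivity, ?_⟩
  intro Ω hΩ hb hA u hu hint Q₀ hQ₀ r hr hrd
  have hd : 0 < diam Ω := hr.trans_le hrd
  have hne : (frontier Ω).Nonempty := ⟨_, hQ₀⟩
  have hfin := sigma_finite' hb hA hd
  set σ := (μH[(n : ℝ) - 1] : Measure (En n)).restrict
    (ball Q₀ ((α + 1) * r) ∩ frontier Ω) with hσ
  haveI : IsFiniteMeasure σ := ⟨by
    rw [hσ, Measure.restrict_apply_univ]
    exact (measure_mono inter_subset_right).trans_lt hfin⟩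
  set f : En n → ℝ := fun X => ‖fderiv ℝ u X‖ ^ 2 with hf
  have hfm : Measurable f := ((measurable_fderiv ℝ u).norm).pow_const 2
  have hf0 : ∀ X, 0 ≤ f X := fun X => by positivity
  set δ : En n → ℝ := fun X => infDist X (frontier Ω) with hδ
  have hδm : Measurable δ := (continuous_infDist_pt _).measurable
  have hδ0 : ∀ X, 0 ≤ δ X := fun X => infDist_nonneg
  set G : En n → ℝ := fun X => f X * δ X ^ ((2 : ℝ) - n) with hG
  have hGm : Measurable G := hfm.mul (hδm.pow_const _)
  have hG0 : ∀ X, 0 ≤ G X := fun X => mul_nonneg (hf0 X) (Real.rpow_nonneg (hδ0 X) _)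
  set S := coneSet n Ω α (α * r) with hS
  have hSm : MeasurableSet S := coneSet_meas n Ω hΩ α (α * r)
  set H : En n → En n → ℝ≥0∞ := fun Q X => S.indicator (fun p => ENNReal.ofReal (G p.2)) (Q, X)
    with hH
  have hHm : Measurable (Function.uncurry H) :=
    ((hGm.comp measurable_snd).ennreal_ofReal).indicator hSm
  set I : En n → ℝ≥0∞ := fun Q => ∫⁻ X, H Q X with hI
  have hIm : Measurable I := hHm.lintegral_prod_right'
  have hsq : ∀ Q, trSq n Ω α (α * r) u Q ^ 2 = (I Q).toReal := by
    intro Q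
    unfold trSq
    rw [Real.sq_sqrt (integral_nonneg fun X => hG0 X)]
    rw [integral_eq_lintegral_of_nonneg_ae (Eventually.of_forall fun X => hG0 X)
      hGm.aestronglyMeasurable]
    congr 1
    have hset : {X ∈ Ω | dist X Q ≤ α * infDist X (frontier Ω)} ∩ ball Q (α * r)
        = (fun X => (Q, X)) ⁻¹' S := rfl
    rw [hset, ← lintegral_indicator (measurable_prodMk_left hSm)]
    rfl
  have hswap : ∫⁻ Q, I Q ∂σ = ∫⁻ X, ENNReal.ofReal (G X) * σ ((fun Q => (Q, X)) ⁻¹' S) := by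
    rw [hI, lintegral_lintegral_swap hHm.aemeasurable]
    refine lintegral_congr fun X => ?_
    have hs : MeasurableSet ((fun Q => (Q, X)) ⁻¹' S) := measurable_prodMk_right hSm
    rw [← lintegral_indicator_const hs]
    rfl
  have hS_out : ∀ X, X ∉ Ω → (fun Q : En n => (Q, X)) ⁻¹' S = ∅ := by
    intro X hX
    ext Q
    simp only [mem_preimage, mem_empty_iff_false, iff_false]
    exact fun h => hX h.1.1
  have hIfin : ∫⁻ Q, I Q ∂σ < ∞ := by
    obtain ⟨K, hK0, hK⟩ := upper_bd hΩ hb hα (hC₁.trans_le hC₁₂) hA hne hd (α * r)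
      ((α + 1) * r) Q₀
    obtain ⟨D, hD⟩ := hb.subset_closedBall Q₀
    have hle : ∀ X, ENNReal.ofReal (G X) * σ ((fun Q => (Q, X)) ⁻¹' S) ≤
        Ω.indicator (fun X => ENNReal.ofReal (K * D) * ENNReal.ofReal (f X)) X := by
      intro X
      by_cases hX : X ∈ Ω
      · rw [indicator_of_mem hX]
        refine (mul_le_mul_right (hK X hX) _).trans ?_
        rw [← ENNReal.ofReal_mul (hG0 X)]
        have hp : 0 < δ X := infDist_pos_of hΩ hne hX
        have hDX : δ X ≤ D := (infDist_le_dist_of_mem hQ₀).trans (hD hX)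
        have hD0 : 0 ≤ D := hp.le.trans hDX
        rw [← ENNReal.ofReal_mul (by positivity)]
        refine ENNReal.ofReal_le_ofReal ?_
        have h3 := rpow_mul_pow' hn hp
        calc G X * (K * δ X ^ (n - 1)) = K * f X * (δ X ^ ((2 : ℝ) - n) * δ X ^ (n - 1)) := by
              simp only [hG]; ring
          _ = K * f X * δ X := by rw [h3]
          _ ≤ K * f X * D := mul_le_mul_of_nonneg_left hDX (mul_nonneg hK0 (hf0 X))
          _ = K * D * f X := by ring
      · rw [hS_out X hX]; simp
    rw [hswap]
    refine (lintegral_mono hle).trans_lt ?_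
    rw [lintegral_indicator hΩ.measurableSet, lintegral_const_mul _ hfm.ennreal_ofReal]
    refine ENNReal.mul_lt_top ENNReal.ofReal_lt_top ?_
    have := hint.hasFiniteIntegral
    rw [hasFiniteIntegral_iff_ofReal (Eventually.of_forall hf0)] at this
    exact this
  have hmain : ENNReal.ofReal (C₁ * m ^ (n - 1)) *
      ∫⁻ X in ball Q₀ r ∩ Ω, ENNReal.ofReal (f X * δ X) ≤ ∫⁻ Q, I Q ∂σ := by
    have hTm : MeasurableSet (ball Q₀ r ∩ Ω) := measurableSet_ball.inter hΩ.measurableSet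
    have hfd : Measurable fun X => ENNReal.ofReal (f X * δ X) := (hfm.mul hδm).ennreal_ofReal
    rw [hswap, ← lintegral_const_mul _ hfd,
      ← lintegral_indicator hTm]
    refine lintegral_mono fun X => ?_
    by_cases hX : X ∈ ball Q₀ r ∩ Ω
    · rw [indicator_of_mem hX]
      refine le_trans (le_of_eq ?_)
        (mul_le_mul_right (lower_bd hΩ hb hC₁ hα hA hQ₀ hrd hX) _)
      have hp : 0 < δ X := infDist_pos_of hΩ hne hX.2
      rw [← ENNReal.ofReal_mul hc0.le, ← ENNReal.ofReal_mul (hG0 X)]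
      congr 1
      have h3 := rpow_mul_pow' hn hp
      calc C₁ * m ^ (n - 1) * (f X * δ X)
          = C₁ * m ^ (n - 1) * (f X * (δ X ^ ((2 : ℝ) - n) * δ X ^ (n - 1))) := by rw [h3]
        _ = _ := by simp only [hG, hδ]; ring
    · rw [indicator_of_notMem hX]; exact zero_le
  have hR : ∫ Q, trSq n Ω α (α * r) u Q ^ 2 ∂σ = (∫⁻ Q, I Q ∂σ).toReal := by
    simp_rw [hsq]
    exact integral_toReal hIm.aemeasurable (ae_lt_top hIm hIfin.ne)
  have hL : ∫ X in ball Q₀ r ∩ Ω, f X * δ X =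
      (∫⁻ X in ball Q₀ r ∩ Ω, ENNReal.ofReal (f X * δ X)).toReal :=
    integral_eq_lintegral_of_nonneg_ae
      (Eventually.of_forall fun X => mul_nonneg (hf0 X) (hδ0 X))
      (hfm.mul hδm).aestronglyMeasurable
  change ∫ X in ball Q₀ r ∩ Ω, f X * δ X ≤ _ * ∫ Q, trSq n Ω α (α * r) u Q ^ 2 ∂σ
  rw [hR, hL, inv_mul_eq_div, le_div_iff₀ hc0, mul_comm]
  have h4 := ENNReal.toReal_mono hIfin.ne hmain
  rwa [ENNReal.toReal_mul, ENNReal.toReal_ofReal hc0.le] at h4
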